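/- arXiv:1111.5935 — 8 statements merged into one kernel-verified Lean document; each statement's English description precedes it below -/
import Mathlib

section
/- Let δ ∈ (0, π] and let n ≥ 1 be an integer with cos(δn) ≤ q ≤ 1 (in particular cos(δn) ≠ 1 when q < 1). Set a = (1 − q)/(1 − cos(δn)). Then 0 ≤ a ≤ 1, and the function p : ℕ × ℕ → ℝ with p(0,0) = 1 − a, p(n,0) = p(0,n) = a/2, and p = 0 elsewhere, is a reading distribution whose overlap satisfies O(p) = q (a nonnegative real number, so |O(p)| = q) and whose energy satisfies E(p) = (1 − q)·n/(1 − cos(δn)). -/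
open scoped Real ENNReal

/-- The overlap `O(p) = Σ_{n,m} p(n,m)·e^{iδ(n−m)}` of a reading distribution. -/
noncomputable def overlap (δ : ℝ) (p : ℕ × ℕ → ℝ) : ℂ :=
  ∑' nm : ℕ × ℕ, (p nm : ℂ) * Complex.exp (Complex.I * δ * ((nm.1 : ℂ) - (nm.2 : ℂ)))

/-- The energy `E(p) = Σ_{n,m} p(n,m)·(n+m) ∈ [0,∞]` of a reading distribution. -/
noncomputable def energy (p : ℕ × ℕ → ℝ) : ℝ≥0∞ :=
  ∑' nm : ℕ × ℕ, ENNReal.ofReal (p nm * ((nm.1 : ℝ) + (nm.2 : ℝ)))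

/-- A reading distribution: summable, nonnegative, total mass one. -/
def IsReadingDist (p : ℕ × ℕ → ℝ) : Prop :=
  Summable p ∧ (∀ nm, 0 ≤ p nm) ∧ ∑' nm : ℕ × ℕ, p nm = 1

/-- A sum over `ℕ × ℕ` of a function supported on `(0,0)`, `(n,0)`, `(0,n)`, with `n ≠ 0`. -/
theorem hasSum_of_noon_support {M : Type*} [AddCommMonoid M] [TopologicalSpace M]
    {n : ℕ} (hn : n ≠ 0) {f : ℕ × ℕ → M}
    (hf : ∀ x, x ≠ (0, 0) → x ≠ (n, 0) → x ≠ (0, n) → f x = 0) :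
    HasSum f (f (0, 0) + (f (n, 0) + f (0, n))) := by
  have h := hasSum_sum_of_ne_finset_zero (f := f) (L := .unconditional _)
    (s := {(0, 0), (n, 0), (0, n)}) (fun x hx => by
      simp only [Finset.mem_insert, Finset.mem_singleton, not_or] at hx
      exact hf x hx.1 hx.2.1 hx.2.2)
  rwa [Finset.sum_insert (by simp [hn.symm]), Finset.sum_pair (by simp [hn])] at h

/-- The superposition of the NOON state `|n,0⟩+|0,n⟩` (weight `a`) and the
vacuum (weight `1−a`), with `a = (1−q)/(1−cos δn)`, is a reading distribution
with real overlap `q` and energy `(1−q)·n/(1−cos δn)`. -/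
theorem noon_vacuum_reading_dist
    (δ : ℝ) (hδ : δ ∈ Set.Ioc 0 π) (n : ℕ) (hn : 1 ≤ n) (q : ℝ)
    (hq1 : Real.cos (δ * n) ≤ q) (hq2 : q ≤ 1) :
    let a : ℝ := (1 - q) / (1 - Real.cos (δ * n))
    let p : ℕ × ℕ → ℝ := fun nm =>
      if nm = (0, 0) then 1 - a
      else if nm = (n, 0) ∨ nm = (0, n) then a / 2 else 0
    0 ≤ a ∧ a ≤ 1 ∧ IsReadingDist p ∧ overlap δ p = (q : ℂ) ∧
      energy p = ENNReal.ofReal ((1 - q) * n / (1 - Real.cos (δ * n))) := by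
  intro a p
  have hn0 : n ≠ 0 := by omega
  have hcos : 0 ≤ 1 - Real.cos (δ * n) := by linarith [Real.cos_le_one (δ * n)]
  have ha0 : 0 ≤ a := div_nonneg (by linarith) hcos
  have ha1 : a ≤ 1 := div_le_one_of_le₀ (by linarith) hcos
  have hmul : a * (1 - Real.cos (δ * n)) = 1 - q :=
    div_mul_cancel_of_imp fun h => by linarith
  have hp0 : p (0, 0) = 1 - a := by simp [p]
  have hp1 : p (n, 0) = a / 2 := by simp [p, hn0]
  have hp2 : p (0, n) = a / 2 := by simp [p, hn0]
  have hp : ∀ x, x ≠ (0, 0) → x ≠ (n, 0) → x ≠ (0, n) → p x = 0 := by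
    intro x h0 h1 h2
    simp [p, h0, h1, h2]
  have hsum : HasSum p 1 := by
    convert hasSum_of_noon_support hn0 hp using 1
    rw [hp0, hp1, hp2]
    ring
  refine ⟨ha0, ha1, ⟨hsum.summable, fun x => ?_, hsum.tsum_eq⟩, ?_, ?_⟩
  · simp only [p]
    split_ifs <;> linarith
  · rw [overlap, (hasSum_of_noon_support hn0 fun x h0 h1 h2 => by simp [hp x h0 h1 h2]).tsum_eq,
      hp0, hp1, hp2]
    have hq : (q : ℂ) = 1 - a * (1 - Complex.cos (δ * n)) := by
      rw [← sub_sub_self 1 q, ← hmul]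
      push_cast
      ring
    have h1 : Complex.I * δ * ((n : ℂ) - (0 : ℕ)) = δ * n * Complex.I := by push_cast; ring
    have h2 : Complex.I * δ * ((0 : ℕ) - (n : ℂ)) = -(δ * n) * Complex.I := by push_cast; ring
    rw [hq, Complex.cos, h1, h2]
    push_cast
    simp only [sub_self, mul_zero, Complex.exp_zero]
    ring
  · rw [energy, (hasSum_of_noon_support hn0 fun x h0 h1 h2 => by simp [hp x h0 h1 h2]).tsum_eq,
      hp0, hp1, hp2, ← ENNReal.ofReal_add (by positivity) (by positivity),
      ← ENNReal.ofReal_add (by simp) (by positivity)]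
    congr 1
    simp only [a]
    push_cast
    ring
end

section
/- Let δ ∈ (0, π], q ∈ [−1, 1], and let w : ℕ → ℝ be a probability distribution (w(n) ≥ 0, Σ_n w(n) = 1) with finite mean Σ_n n·w(n) < ∞ and with Σ_n w(n)·cos(δn) = q. Then there exist n₁, n₂ ∈ ℕ and a probability distribution w' on ℕ supported on {n₁, n₂} such that Σ_n w'(n)·cos(δn) = q and Σ_n n·w'(n) ≤ Σ_n n·w(n). (The energy-minimizing distribution subject to a fixed cosine moment can be taken to be supported on at most two points.) -/
open scoped Real

/-- If nonnegative weights `w` of total mass one put the barycentre of the planar points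
`(x k, y k)` at the origin, then some convex combination of two of the points has first
coordinate zero and nonpositive second coordinate. -/
theorem exists_two_point_combination {ι : Type*} {w x y : ι → ℝ} (hw : ∀ k, 0 ≤ w k)
    (hw1 : HasSum w 1) (hx : HasSum (fun k => w k * x k) 0) (hy : HasSum (fun k => w k * y k) 0) :
    ∃ (i j : ι) (p : ℝ), 0 ≤ p ∧ p ≤ 1 ∧ p * x i + (1 - p) * x j = 0 ∧
      p * y i + (1 - p) * y j ≤ 0 := by
  by_contra! h
  have hzero (k : ι) (hk : x k = 0) : 0 < y k := by
    simpa using h k k 1 zero_le_one le_rfl (by simp [hk])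
  have hpair (i j : ι) (hi : x i < 0) (hj : 0 < x j) : -y j / x j < y i / -x i := by
    have hd : 0 < x j - x i := by linarith
    have hp : 1 - x j / (x j - x i) = -x i / (x j - x i) := by field_simp; ring
    have := h i j (x j / (x j - x i)) (by positivity)
      ((div_le_one hd).2 (by linarith)) (by rw [hp]; field_simp; ring)
    have hE : x j / (x j - x i) * y i + (1 - x j / (x j - x i)) * y j =
        (x j * y i - x i * y j) / (x j - x i) := by rw [hp]; field_simp; ring
    rw [hE, div_pos_iff_of_pos_right hd] at this
    rw [div_lt_div_iff₀ hj (by linarith)]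
    linarith
  have vanish {f : ι → ℝ} (hf : HasSum (fun k => w k * f k) 0) (h0 : ∀ k, 0 ≤ w k * f k)
      (k : ι) (hk : 0 < w k) : f k = 0 := by
    have := congrFun ((hasSum_zero_iff_of_nonneg h0).1 hf) k
    simpa [hk.ne'] using this
  obtain ⟨k, hk⟩ : ∃ k, 0 < w k := by
    by_contra! hle
    have : w = 0 := funext fun k => le_antisymm (hle k) (hw k)
    subst this
    exact one_ne_zero (hw1.unique hasSum_zero)
  -- A supporting line through the origin vanishes on the support of `w`.
  have no_line (l : ℝ) (hl : ∀ k, 0 ≤ y k + l * x k) (i j : ι) (hi : x i < 0) (hj : 0 < x j)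
      (hwi : 0 < w i) (hwj : 0 < w j) : False := by
    have hs : HasSum (fun k => w k * (y k + l * x k)) 0 := by
      convert hy.add (hx.mul_left l) using 1
      · ext k; ring
      · simp
    have v := vanish hs fun k => mul_nonneg (hw k) (hl k)
    have e := hpair i j hi hj
    rw [div_lt_div_iff₀ hj (by linarith)] at e
    have hyi : y i = -l * x i := by linarith [v i hwi]
    have hyj : y j = -l * x j := by linarith [v j hwj]
    rw [hyi, hyj] at e
    linarith
  by_cases hneg : ∃ i, 0 < w i ∧ x i < 0
  · by_cases hpos : ∃ j, 0 < w j ∧ 0 < x j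
    · obtain ⟨i, hwi, hi⟩ := hneg
      obtain ⟨j, hwj, hj⟩ := hpos
      obtain ⟨l, hlu, hll⟩ := exists_between_of_forall_le
        (s := (fun j => -y j / x j) '' {j | 0 < x j})
        (t := (fun i => y i / -x i) '' {i | x i < 0}) ⟨_, j, hj, rfl⟩ ⟨_, i, hi, rfl⟩
        (by rintro _ ⟨j, hj, rfl⟩ _ ⟨i, hi, rfl⟩; exact (hpair i j hi hj).le)
      refine no_line l (fun k => ?_) i j hi hj hwi hwj
      rcases lt_trichotomy (x k) 0 with hxk | hxk | hxk
      · have := hll ⟨k, hxk, rfl⟩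
        rw [le_div_iff₀ (by linarith)] at this
        linarith
      · simpa [hxk] using (hzero k hxk).le
      · have := hlu ⟨k, hxk, rfl⟩
        rw [div_le_iff₀ hxk] at this
        linarith
    · push Not at hpos
      obtain ⟨i, hwi, hi⟩ := hneg
      have hs : HasSum (fun k => w k * -x k) 0 := by simpa using hx.neg
      have := vanish hs (fun k => ?_) i hwi
      · linarith
      · rcases (hw k).eq_or_lt with h0 | h0
        · simp [← h0]
        · exact mul_nonneg (hw k) (by linarith [hpos k h0])
  · push Not at hneg
    have v := vanish hx fun k => by
      rcases (hw k).eq_or_lt with h0 | h0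
      · simp [← h0]
      · exact mul_nonneg (hw k) (hneg k h0)
    have := vanish hy (fun k => ?_) k hk
    · linarith [hzero k (v k hk)]
    · rcases (hw k).eq_or_lt with h0 | h0
      · simp [← h0]
      · exact mul_nonneg (hw k) (hzero k (v k h0)).le

theorem hasSum_single_add_single_mul {ι : Type*} [DecidableEq ι] (i j : ι) (a b : ℝ) (g : ι → ℝ) :
    HasSum (fun n => (Pi.single i a + Pi.single j b : ι → ℝ) n * g n) (a * g i + b * g j) := by
  have hs (i : ι) (a : ℝ) :
      HasSum (fun n => (Pi.single i a : ι → ℝ) n * g n) (a * g i) := by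
    simpa using hasSum_single (f := fun n => (Pi.single i a : ι → ℝ) n * g n) i
      fun n hn => by simp [hn]
  simpa [add_mul] using (hs i a).add (hs j b)

/-- The energy-minimizing distribution on `ℕ` subject to a fixed cosine moment
`Σ_n w(n)·cos(δn) = q` can be taken to be supported on at most two points. -/
theorem two_point_support_suffices
    (δ : ℝ) (hδ : δ ∈ Set.Ioc 0 π) (q : ℝ) (hq : q ∈ Set.Icc (-1 : ℝ) 1)
    (w : ℕ → ℝ) (hw0 : ∀ n, 0 ≤ w n) (hwsum : Summable w)
    (hw1 : (∑' n : ℕ, w n) = 1)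
    (hmean : Summable fun n : ℕ => (n : ℝ) * w n)
    (hmom : (∑' n : ℕ, w n * Real.cos (δ * n)) = q) :
    ∃ (n₁ n₂ : ℕ) (w' : ℕ → ℝ),
      (∀ n, 0 ≤ w' n) ∧ Summable w' ∧ (∑' n : ℕ, w' n) = 1 ∧
      (∀ n, w' n ≠ 0 → n = n₁ ∨ n = n₂) ∧
      (∑' n : ℕ, w' n * Real.cos (δ * n)) = q ∧
      (∑' n : ℕ, (n : ℝ) * w' n) ≤ ∑' n : ℕ, (n : ℝ) * w n := by
  have hW : HasSum w 1 := by simpa only [hw1] using hwsum.hasSum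
  have hcos : Summable fun n : ℕ => w n * Real.cos (δ * n) :=
    hwsum.of_norm_bounded fun n => by
      rw [Real.norm_eq_abs, abs_mul, abs_of_nonneg (hw0 n)]
      exact mul_le_of_le_one_right (hw0 n) (Real.abs_cos_le_one _)
  obtain ⟨m, hm⟩ := hmean
  have hQ : HasSum (fun n : ℕ => w n * Real.cos (δ * n)) q := by
    simpa only [hmom] using hcos.hasSum
  have hx : HasSum (fun n : ℕ => w n * (Real.cos (δ * n) - q)) 0 := by
    simpa [mul_sub] using hQ.sub (hW.mul_right q)
  have hy : HasSum (fun n : ℕ => w n * ((n : ℝ) - m)) 0 := by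
    simpa [mul_sub, mul_comm] using hm.sub (hW.mul_right m)
  obtain ⟨i, j, p, hp0, hp1, hpx, hpy⟩ := exists_two_point_combination hw0 hW hx hy
  have H := hasSum_single_add_single_mul i j p (1 - p)
  have H1 : HasSum (Pi.single i p + Pi.single j (1 - p) : ℕ → ℝ) 1 := by
    simpa only [mul_one, add_sub_cancel] using H fun _ => 1
  have Hcos : ∑' n : ℕ, (Pi.single i p + Pi.single j (1 - p) : ℕ → ℝ) n * Real.cos (δ * n) = q := by
    rw [(H fun n : ℕ => Real.cos (δ * n)).tsum_eq]
    linarith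
  have Hmean : ∑' n : ℕ, (n : ℝ) * (Pi.single i p + Pi.single j (1 - p) : ℕ → ℝ) n ≤ m := by
    rw [tsum_congr fun n : ℕ => mul_comm (n : ℝ) _, (H fun n : ℕ => (n : ℝ)).tsum_eq]
    linarith
  have H0 : 0 ≤ (Pi.single i p + Pi.single j (1 - p) : ℕ → ℝ) :=
    add_nonneg (Pi.single_nonneg.2 hp0) (Pi.single_nonneg.2 (sub_nonneg.2 hp1))
  have Hsupp (n : ℕ) (hn : (Pi.single i p + Pi.single j (1 - p) : ℕ → ℝ) n ≠ 0) :
      n = i ∨ n = j := by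
    by_contra! hne
    exact hn (by simp [hne.1, hne.2])
  exact ⟨i, j, _, H0, H1.summable, H1.tsum_eq, Hsupp, Hcos, hm.tsum_eq.symm ▸ Hmean⟩
end

section
/- Let δ ∈ (0, π] and let x* be the unique real number in the interval (π/(2δ), π/δ) satisfying δ·x* = tan(δ·x*/2). Then for every integer n ≥ 1 with cos(δn) ≠ 1, one has n/(1 − cos(δn)) ≥ min { m/(1 − cos(δm)) : m ∈ {⌊x*⌋, ⌈x*⌉}, m ≥ 1 }. In other words, the minimum of g over the positive integers is attained at ⌊x*⌋ or ⌈x*⌉ (at ⌈x*⌉ when ⌊x*⌋ = 0). -/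
open scoped Real

/-- The numerator of the derivative of `(1 - cos t) / t`. -/
theorem hasDerivAt_mul_sin_add_cos (t : ℝ) :
    HasDerivAt (fun t : ℝ => t * Real.sin t - 1 + Real.cos t) (t * Real.cos t) t := by
  have h := (((hasDerivAt_id t).mul (Real.hasDerivAt_sin t)).sub_const 1).add
    (Real.hasDerivAt_cos t)
  refine h.congr_deriv ?_
  simp

theorem hasDerivAt_one_sub_cos_div {t : ℝ} (ht : t ≠ 0) :
    HasDerivAt (fun t : ℝ => (1 - Real.cos t) / t)
      ((t * Real.sin t - 1 + Real.cos t) / t ^ 2) t := by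
  refine (((Real.hasDerivAt_cos t).const_sub 1).div (hasDerivAt_id t) ht).congr_deriv ?_
  simp only [id]
  ring

theorem monotoneOn_mul_sin_add_cos :
    MonotoneOn (fun t : ℝ => t * Real.sin t - 1 + Real.cos t) (Set.Icc 0 (π / 2)) := by
  refine monotoneOn_of_deriv_nonneg (convex_Icc _ _) (by fun_prop) (by fun_prop) fun t ht => ?_
  rw [interior_Icc] at ht
  rw [(hasDerivAt_mul_sin_add_cos t).deriv]
  exact mul_nonneg ht.1.le (Real.cos_nonneg_of_neg_pi_div_two_le_of_le
    (by linarith [ht.1, Real.pi_pos]) ht.2.le)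

theorem antitoneOn_mul_sin_add_cos :
    AntitoneOn (fun t : ℝ => t * Real.sin t - 1 + Real.cos t) (Set.Icc (π / 2) π) := by
  refine antitoneOn_of_deriv_nonpos (convex_Icc _ _) (by fun_prop) (by fun_prop) fun t ht => ?_
  rw [interior_Icc] at ht
  rw [(hasDerivAt_mul_sin_add_cos t).deriv]
  exact mul_nonpos_of_nonneg_of_nonpos (by linarith [ht.1, Real.pi_pos])
    (Real.cos_nonpos_of_pi_div_two_le_of_le ht.1.le (by linarith [ht.2, Real.pi_pos]))

theorem mul_sin_add_cos_eq_zero {s : ℝ} (hs : s ∈ Set.Ioo (π / 2) π)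
    (h : s = Real.tan (s / 2)) : s * Real.sin s - 1 + Real.cos s = 0 := by
  have hc : Real.cos (s / 2) ≠ 0 :=
    (Real.cos_pos_of_mem_Ioo ⟨by linarith [hs.1, Real.pi_pos], by linarith [hs.2]⟩).ne'
  have hsc : s * Real.cos (s / 2) = Real.sin (s / 2) := by
    rw [Real.tan_eq_sin_div_cos, eq_div_iff hc] at h
    exact h
  have hsin : Real.sin s = 2 * Real.sin (s / 2) * Real.cos (s / 2) := by
    rw [← Real.sin_two_mul, mul_div_cancel₀ s two_ne_zero]
  have hcos : Real.cos s = 2 * Real.cos (s / 2) ^ 2 - 1 := by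
    rw [← Real.cos_two_mul, mul_div_cancel₀ s two_ne_zero]
  rw [hsin, hcos]
  linear_combination 2 * Real.sin (s / 2) * hsc + 2 * Real.sin_sq_add_cos_sq (s / 2)

theorem monotoneOn_one_sub_cos_div {s : ℝ} (hs : s ∈ Set.Ioo (π / 2) π)
    (h : s = Real.tan (s / 2)) :
    MonotoneOn (fun t : ℝ => (1 - Real.cos t) / t) (Set.Ioc 0 s) := by
  refine monotoneOn_of_deriv_nonneg (convex_Ioc _ _)
    (fun t ht => (hasDerivAt_one_sub_cos_div ht.1.ne').continuousAt.continuousWithinAt)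
    (fun t ht => (hasDerivAt_one_sub_cos_div
      (interior_subset ht).1.ne').differentiableAt.differentiableWithinAt) fun t ht => ?_
  rw [interior_Ioc] at ht
  rw [(hasDerivAt_one_sub_cos_div ht.1.ne').deriv]
  refine div_nonneg ?_ (sq_nonneg t)
  have hpi := Real.pi_pos
  rcases le_total t (π / 2) with htp | htp
  · have := monotoneOn_mul_sin_add_cos ⟨le_rfl, by linarith⟩ ⟨ht.1.le, htp⟩ ht.1.le
    simpa using this
  · have := antitoneOn_mul_sin_add_cos ⟨htp, ht.2.le.trans hs.2.le⟩ ⟨hs.1.le, hs.2.le⟩ ht.2.le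
    simp only [mul_sin_add_cos_eq_zero hs h] at this
    exact this

theorem antitoneOn_one_sub_cos_div {s : ℝ} (hs : s ∈ Set.Ioo (π / 2) π)
    (h : s = Real.tan (s / 2)) :
    AntitoneOn (fun t : ℝ => (1 - Real.cos t) / t) (Set.Icc s (2 * π)) := by
  have hpi := Real.pi_pos
  have hs0 : 0 < s := by linarith [hs.1]
  refine antitoneOn_of_deriv_nonpos (convex_Icc _ _)
    (fun t ht => (hasDerivAt_one_sub_cos_div
      (hs0.trans_le ht.1).ne').continuousAt.continuousWithinAt)
    (fun t ht => (hasDerivAt_one_sub_cos_div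
      (hs0.trans_le (interior_subset ht).1).ne').differentiableAt.differentiableWithinAt)
    fun t ht => ?_
  rw [interior_Icc] at ht
  have ht0 : 0 < t := hs0.trans ht.1
  rw [(hasDerivAt_one_sub_cos_div ht0.ne').deriv]
  refine div_nonpos_of_nonpos_of_nonneg ?_ (sq_nonneg t)
  rcases le_total t π with htp | htp
  · have := antitoneOn_mul_sin_add_cos ⟨hs.1.le, hs.2.le⟩ ⟨(hs.1.trans ht.1).le, htp⟩ ht.1.le
    simp only [mul_sin_add_cos_eq_zero hs h] at this
    exact this
  · have hsin : Real.sin t ≤ 0 := by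
      rw [← Real.sin_sub_two_pi]
      exact Real.sin_nonpos_of_nonpos_of_neg_pi_le (by linarith [ht.2]) (by linarith)
    linarith [mul_nonpos_of_nonneg_of_nonpos ht0.le hsin, Real.cos_le_one t]

/-- `t / (1 - cos t) ≤ π` on `[π / 3, 4 * π / 3]`, stated for `(1 - cos t) / t`. -/
theorem one_div_pi_le_one_sub_cos_div {s t : ℝ} (hs : s ∈ Set.Ioo (π / 2) π)
    (h : s = Real.tan (s / 2)) (ht : t ∈ Set.Icc (π / 3) (4 * π / 3)) :
    1 / π ≤ (1 - Real.cos t) / t := by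
  have hpi := Real.pi_pos
  rcases le_total t s with hts | hts
  · refine le_trans ?_ (monotoneOn_one_sub_cos_div hs h (a := π / 3)
      ⟨by linarith, by linarith [hs.1]⟩ ⟨by linarith [ht.1], hts⟩ ht.1)
    simp only [Real.cos_pi_div_three]
    rw [div_le_div_iff₀ hpi (by linarith)]
    linarith
  · refine le_trans ?_ (antitoneOn_one_sub_cos_div hs h (b := 4 * π / 3)
      ⟨hts, by linarith [ht.2]⟩ ⟨by linarith [hs.2], by linarith⟩ ht.2)
    have hcos : Real.cos (4 * π / 3) = -(1 / 2) := by
      rw [show 4 * π / 3 = π / 3 + π by ring, Real.cos_add_pi, Real.cos_pi_div_three]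
    simp only [hcos]
    rw [div_le_div_iff₀ hpi (by linarith)]
    linarith

theorem div_one_sub_cos_le_of_le {δ a b : ℝ} (hδ : 0 < δ) (hb : 0 < b)
    (hcos : Real.cos (δ * b) ≠ 1)
    (h : (1 - Real.cos (δ * b)) / (δ * b) ≤ (1 - Real.cos (δ * a)) / (δ * a)) :
    a / (1 - Real.cos (δ * a)) ≤ b / (1 - Real.cos (δ * b)) := by
  have hB : 0 < 1 - Real.cos (δ * b) := sub_pos.2 (lt_of_le_of_ne (Real.cos_le_one _) hcos)
  have key := one_div_le_one_div_of_le (div_pos hB (mul_pos hδ hb)) h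
  rw [one_div_div, one_div_div, mul_div_assoc, mul_div_assoc] at key
  exact le_of_mul_le_mul_left key hδ

/-- The minimum of `g(n) = n/(1 − cos δn)` over the positive integers with
`cos δn ≠ 1` is attained at `⌊x*⌋` or `⌈x*⌉`, where `x* ∈ (π/(2δ), π/δ)` is the
solution of `δx = tan(δx/2)`. -/
theorem integer_minimum_at_floor_or_ceil
    (δ : ℝ) (hδ : δ ∈ Set.Ioc 0 π) (x : ℝ)
    (hx : x ∈ Set.Ioo (π / (2 * δ)) (π / δ))
    (hxuniq : ∀ y ∈ Set.Ioo (π / (2 * δ)) (π / δ),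
      δ * y = Real.tan (δ * y / 2) → y = x)
    (hxeq : δ * x = Real.tan (δ * x / 2)) :
    ∀ n : ℕ, 1 ≤ n → Real.cos (δ * n) ≠ 1 →
      sInf {y : ℝ | ∃ m : ℕ, (m = ⌊x⌋₊ ∨ m = ⌈x⌉₊) ∧ 1 ≤ m ∧
          y = (m : ℝ) / (1 - Real.cos (δ * m))}
        ≤ (n : ℝ) / (1 - Real.cos (δ * n)) := by
  intro n hn hcos
  have hpi := Real.pi_pos
  have hδ0 : 0 < δ := hδ.1
  have hs : δ * x ∈ Set.Ioo (π / 2) π := by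
    have h1 := hx.1
    have h2 := hx.2
    rw [div_lt_iff₀ (by linarith)] at h1
    rw [lt_div_iff₀ hδ0] at h2
    constructor <;> linarith
  have hx0 : 0 < x := pos_of_mul_pos_right (by linarith [hs.1]) hδ0.le
  have hn0 : (0 : ℝ) < n := by exact_mod_cast hn
  have hle : ∀ m : ℕ, (m = ⌊x⌋₊ ∨ m = ⌈x⌉₊) → 1 ≤ m →
      (1 - Real.cos (δ * n)) / (δ * n) ≤ (1 - Real.cos (δ * m)) / (δ * m) →
      sInf {y : ℝ | ∃ m : ℕ, (m = ⌊x⌋₊ ∨ m = ⌈x⌉₊) ∧ 1 ≤ m ∧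
          y = (m : ℝ) / (1 - Real.cos (δ * m))} ≤ (n : ℝ) / (1 - Real.cos (δ * n)) := by
    intro m hm hm1 h
    refine le_trans (csInf_le ⟨0, ?_⟩ ⟨m, hm, hm1, rfl⟩)
      (div_one_sub_cos_le_of_le hδ0 hn0 hcos h)
    rintro _ ⟨k, -, -, rfl⟩
    exact div_nonneg k.cast_nonneg (sub_nonneg.2 (Real.cos_le_one _))
  have hfloor : δ * (⌊x⌋₊ : ℝ) ≤ δ * x := mul_le_mul_of_nonneg_left (Nat.floor_le hx0.le) hδ0.le
  have hceil : δ * x ≤ δ * (⌈x⌉₊ : ℝ) := mul_le_mul_of_nonneg_left (Nat.le_ceil x) hδ0.le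
  have hceil1 : 1 ≤ ⌈x⌉₊ := Nat.ceil_pos.2 hx0
  rcases le_or_gt n ⌊x⌋₊ with hnf | hnf
  · have h : δ * (n : ℝ) ≤ δ * (⌊x⌋₊ : ℝ) :=
      mul_le_mul_of_nonneg_left (by exact_mod_cast hnf) hδ0.le
    have hpos : 0 < δ * (n : ℝ) := mul_pos hδ0 hn0
    exact hle _ (.inl rfl) (hn.trans hnf) (monotoneOn_one_sub_cos_div hs hxeq
      ⟨hpos, h.trans hfloor⟩ ⟨hpos.trans_le h, hfloor⟩ h)
  rcases le_or_gt (δ * n) (2 * π) with hn2 | hn2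
  · have hcn : ⌈x⌉₊ ≤ n := (Nat.ceil_le_floor_add_one x).trans hnf
    have h : δ * (⌈x⌉₊ : ℝ) ≤ δ * (n : ℝ) :=
      mul_le_mul_of_nonneg_left (by exact_mod_cast hcn) hδ0.le
    exact hle _ (.inr rfl) hceil1 (antitoneOn_one_sub_cos_div hs hxeq
      ⟨hceil, h.trans hn2⟩ ⟨hceil.trans h, hn2⟩ h)
  have hfar : (1 - Real.cos (δ * n)) / (δ * n) ≤ 1 / π := by
    rw [div_le_div_iff₀ (by linarith) hpi]
    nlinarith [Real.neg_one_le_cos (δ * n)]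
  rcases le_or_gt (π / 3) (δ * (⌊x⌋₊ : ℝ)) with hf | hf
  · have hf1 : 1 ≤ ⌊x⌋₊ := by
      refine Nat.one_le_iff_ne_zero.2 fun h0 => ?_
      rw [h0, Nat.cast_zero, mul_zero] at hf
      linarith
    exact hle _ (.inl rfl) hf1 (hfar.trans
      (one_div_pi_le_one_sub_cos_div hs hxeq ⟨hf, by linarith [hs.2]⟩))
  · have hcf : (⌈x⌉₊ : ℝ) ≤ ⌊x⌋₊ + 1 := by exact_mod_cast Nat.ceil_le_floor_add_one x
    have hc := mul_le_mul_of_nonneg_left hcf hδ0.le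
    exact hle _ (.inr rfl) hceil1 (hfar.trans
      (one_div_pi_le_one_sub_cos_div hs hxeq ⟨by linarith [hs.1], by linarith [hδ.2]⟩))
end

section
/- For every δ > 0, the function g(x) = x/(1 − cos(δx)) is convex on the closed interval [π/(2δ), π/δ]. -/
open scoped Real

theorem one_sub_cos_pos {t : ℝ} (h₀ : 0 < t) (h₁ : t ≤ π) : 0 < 1 - Real.cos t := by
  have := Real.cos_lt_cos_of_nonneg_of_le_pi le_rfl h₁ h₀
  rw [Real.cos_zero] at this
  linarith

theorem two_mul_sin_le_mul_two_add_cos {t : ℝ} (ht : 3 / 2 ≤ t) :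
    2 * Real.sin t ≤ t * (2 + Real.cos t) := by
  have hc := Real.neg_one_le_cos t
  have hsc := Real.sin_sq_add_cos_sq t
  have hs : 2 * Real.sin t ≤ 3 / 2 * (2 + Real.cos t) := by
    nlinarith [sq_nonneg (Real.sin t - 4 / 5), sq_nonneg (Real.cos t + 3 / 5)]
  nlinarith

theorem hasDerivAt_div_one_sub_cos {δ x : ℝ} (hx : 1 - Real.cos (δ * x) ≠ 0) :
    HasDerivAt (fun x : ℝ => x / (1 - Real.cos (δ * x)))
      ((1 - Real.cos (δ * x) - x * (δ * Real.sin (δ * x))) / (1 - Real.cos (δ * x)) ^ 2) x := by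
  have hm : HasDerivAt (fun x : ℝ => δ * x) δ x := by
    simpa using (hasDerivAt_id x).const_mul δ
  refine ((hasDerivAt_id x).div (hm.cos.const_sub 1) hx).congr_deriv ?_
  simp only [id_eq]
  ring

theorem hasDerivAt_deriv_div_one_sub_cos {δ x : ℝ} (hx : 1 - Real.cos (δ * x) ≠ 0) :
    HasDerivAt
      (fun x : ℝ =>
        (1 - Real.cos (δ * x) - x * (δ * Real.sin (δ * x))) / (1 - Real.cos (δ * x)) ^ 2)
      (δ * (δ * x * (2 + Real.cos (δ * x)) - 2 * Real.sin (δ * x)) /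
        (1 - Real.cos (δ * x)) ^ 2) x := by
  have hm : HasDerivAt (fun x : ℝ => δ * x) δ x := by
    simpa using (hasDerivAt_id x).const_mul δ
  have hd := hm.cos.const_sub 1
  refine ((hd.sub ((hasDerivAt_id x).mul (hm.sin.const_mul δ))).div (hd.pow 2)
    (pow_ne_zero 2 hx)).congr_deriv ?_
  simp only [id_eq, Pi.sub_apply, Pi.mul_apply, Pi.pow_apply]
  have hsc := Real.sin_sq_add_cos_sq (δ * x)
  generalize Real.sin (δ * x) = s at *
  generalize Real.cos (δ * x) = c at *
  rw [div_eq_div_iff (pow_ne_zero 2 (pow_ne_zero 2 hx)) (pow_ne_zero 2 hx)]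
  push_cast
  linear_combination (2 * x * δ ^ 2 * (1 - c) ^ 3) * hsc

/-- For every `δ > 0`, the function `g(x) = x/(1 − cos δx)` is convex on the
closed interval `[π/(2δ), π/δ]`. -/
theorem g_convexOn (δ : ℝ) (hδ : 0 < δ) :
    ConvexOn ℝ (Set.Icc (π / (2 * δ)) (π / δ))
      (fun x : ℝ => x / (1 - Real.cos (δ * x))) := by
  have hbounds : ∀ x ∈ Set.Icc (π / (2 * δ)) (π / δ), 3 / 2 ≤ δ * x ∧ δ * x ≤ π := by
    rintro x ⟨h₁, h₂⟩
    rw [div_le_iff₀ (by positivity)] at h₁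
    rw [le_div_iff₀ hδ] at h₂
    constructor <;> linarith [Real.pi_gt_three]
  have hpos : ∀ x ∈ Set.Icc (π / (2 * δ)) (π / δ), 0 < 1 - Real.cos (δ * x) := fun x hx =>
    one_sub_cos_pos (by linarith [(hbounds x hx).1]) (hbounds x hx).2
  refine convexOn_of_hasDerivWithinAt2_nonneg (convex_Icc _ _)
    (fun x hx => (hasDerivAt_div_one_sub_cos (hpos x hx).ne').continuousAt.continuousWithinAt)
    (fun x hx =>
      (hasDerivAt_div_one_sub_cos (hpos x (interior_subset hx)).ne').hasDerivWithinAt)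
    (fun x hx =>
      (hasDerivAt_deriv_div_one_sub_cos (hpos x (interior_subset hx)).ne').hasDerivWithinAt)
    fun x hx => ?_
  have h := two_mul_sin_le_mul_two_add_cos (hbounds x (interior_subset hx)).1
  exact div_nonneg (mul_nonneg hδ.le (sub_nonneg.2 h)) (sq_nonneg _)
end

section
/- Let δ ∈ (0, π] and let P : ℕ × ℕ × ℕ → ℝ be summable with P(n,m,k) ≥ 0 and Σ_{n,m,k} P(n,m,k) = 1 (here n, m are the photon numbers of the two system modes traversing the unknown beamsplitter and k is the photon number of an ancillary mode). Define the marginal p(n,m) = Σ_k P(n,m,k). Then p is a reading distribution, its overlap satisfies Σ_{n,m} p(n,m)·e^{iδ(n−m)} = Σ_{n,m,k} P(n,m,k)·e^{iδ(n−m)}, and its energy satisfies Σ_{n,m} p(n,m)·(n+m) ≤ Σ_{n,m,k} P(n,m,k)·(n+m+k). Hence discarding the ancillary mode leaves the failure probability of unambiguous discrimination unchanged and does not increase the total energy of the input state: no ancillary modes are required for optimal unambiguous quantum reading. -/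
open scoped Real ENNReal

/-- The phase acquired by a Fock component with photon numbers `n` and `m` is unimodular. -/
theorem norm_exp_I_mul_sub_eq_one (δ : ℝ) (n m : ℕ) :
    ‖Complex.exp (Complex.I * δ * ((n : ℂ) - (m : ℂ)))‖ = 1 := by
  have h : Complex.I * δ * ((n : ℂ) - (m : ℂ)) = Complex.I * ((δ * ((n : ℝ) - m) : ℝ) : ℂ) := by
    push_cast
    ring
  rw [h, Complex.norm_exp_I_mul_ofReal]

/-- No ancillary modes are required: marginalizing the ancillary mode of a
three-mode input distribution yields a reading distribution with the same
overlap and no greater energy. -/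
theorem no_ancilla_needed
    (δ : ℝ) (hδ : δ ∈ Set.Ioc 0 π) (P : ℕ × ℕ × ℕ → ℝ)
    (hPsum : Summable P) (hP0 : ∀ x, 0 ≤ P x)
    (hP1 : (∑' x : ℕ × ℕ × ℕ, P x) = 1)
    (p : ℕ × ℕ → ℝ) (hp : ∀ n m : ℕ, p (n, m) = ∑' k : ℕ, P (n, m, k)) :
    IsReadingDist p ∧
    overlap δ p = ∑' x : ℕ × ℕ × ℕ,
      (P x : ℂ) * Complex.exp (Complex.I * δ * ((x.1 : ℂ) - (x.2.1 : ℂ))) ∧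
    energy p ≤ ∑' x : ℕ × ℕ × ℕ,
      ENNReal.ofReal (P x * ((x.1 : ℝ) + (x.2.1 : ℝ) + (x.2.2 : ℝ))) := by
  have hQ : Summable fun y : (ℕ × ℕ) × ℕ => P (y.1.1, y.1.2, y.2) :=
    (Equiv.prodAssoc ℕ ℕ ℕ).summable_iff.mpr hPsum
  have hp' : p = fun nm : ℕ × ℕ => ∑' k : ℕ, P (nm.1, nm.2, k) :=
    funext fun nm => hp nm.1 nm.2
  refine ⟨⟨?_, ?_, ?_⟩, ?_, ?_⟩
  · rw [hp']
    exact hQ.prod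
  · intro nm
    rw [hp']
    exact tsum_nonneg fun k => hP0 _
  · rw [hp', ← hQ.tsum_prod, ← hP1]
    exact (Equiv.prodAssoc ℕ ℕ ℕ).tsum_eq P
  · have hC : Summable fun y : (ℕ × ℕ) × ℕ => (P (y.1.1, y.1.2, y.2) : ℂ) *
        Complex.exp (Complex.I * δ * ((y.1.1 : ℂ) - (y.1.2 : ℂ))) := by
      refine Summable.of_norm_bounded hQ fun y => ?_
      rw [norm_mul, norm_exp_I_mul_sub_eq_one, mul_one, Complex.norm_real,
        Real.norm_of_nonneg (hP0 _)]
    rw [← (Equiv.prodAssoc ℕ ℕ ℕ).tsum_eq]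
    refine Eq.trans ?_ hC.tsum_prod.symm
    refine tsum_congr fun nm => ?_
    dsimp only
    rw [tsum_mul_right, hp', Complex.ofReal_tsum]
  · rw [← (Equiv.prodAssoc ℕ ℕ ℕ).tsum_eq, ENNReal.tsum_prod']
    refine ENNReal.tsum_le_tsum fun nm => ?_
    have hk : Summable fun k : ℕ => P (nm.1, nm.2, k) := hQ.prod_factor nm
    rw [hp', ← tsum_mul_right, ENNReal.ofReal_tsum_of_nonneg
      (fun k => mul_nonneg (hP0 _) (by positivity)) (hk.mul_right _)]
    refine ENNReal.tsum_le_tsum fun k => ENNReal.ofReal_le_ofReal ?_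
    exact mul_le_mul_of_nonneg_left (le_add_of_nonneg_right k.cast_nonneg) (hP0 _)
end

section
/- Let 0 ≤ r ≤ 1, t = √(1 − r²), r_B = √(r/(1+r)), t_B = √(1/(1+r)). Define real 3×3 matrices: B = the 2×2 matrix [[r_B, −t_B], [t_B, r_B]] embedded on coordinates (2,3) (identity on coordinate 1); B' = [[r_B, t_B], [−t_B, r_B]] embedded on coordinates (2,3); U = [[−r, −t], [t, −r]] embedded on coordinates (1,2) (identity on coordinate 3). Let e₃ = (0,0,1). Then: (i) B'·B·e₃ = e₃ (so with the device I = identity inserted, the photon exits in mode 3 with probability 1); (ii) the vector v = B'·U·B·e₃ satisfies v₁² = 1 − r, v₂² = r, and v₃ = 0. Hence the setup perfectly discriminates the beamsplitter U from the identity with a single photon: detectors on modes 1 and 2 fire only when the device is U (with total probability 1), and the detector on mode 3 fires only when the device is the identity. -/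
open Matrix

/-- Perfect single-photon discrimination of a beamsplitter `U` (amplitude
reflectivity `r`, with `π/2` phase shifts incorporated) from the identity:
with device `I` the photon always exits in mode 3, with device `U` it always
exits in modes 1 or 2 (with probabilities `1−r` and `r`). -/
theorem perfect_quantum_reading_setup (r : ℝ) (hr : r ∈ Set.Icc (0 : ℝ) 1) :
    let t : ℝ := Real.sqrt (1 - r ^ 2)
    let rB : ℝ := Real.sqrt (r / (1 + r))
    let tB : ℝ := Real.sqrt (1 / (1 + r))
    let B : Matrix (Fin 3) (Fin 3) ℝ := !![1, 0, 0; 0, rB, -tB; 0, tB, rB]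
    let B' : Matrix (Fin 3) (Fin 3) ℝ := !![1, 0, 0; 0, rB, tB; 0, -tB, rB]
    let U : Matrix (Fin 3) (Fin 3) ℝ := !![-r, -t, 0; t, -r, 0; 0, 0, 1]
    let e₃ : Fin 3 → ℝ := ![0, 0, 1]
    B' *ᵥ (B *ᵥ e₃) = e₃ ∧
    (let v : Fin 3 → ℝ := B' *ᵥ (U *ᵥ (B *ᵥ e₃))
     v 0 ^ 2 = 1 - r ∧ v 1 ^ 2 = r ∧ v 2 = 0) := by
  intro t rB tB B B' U e₃
  obtain ⟨hr0, hr1⟩ := hr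
  have hpos : 0 < 1 + r := by linarith
  have ht : t ^ 2 = 1 - r ^ 2 := Real.sq_sqrt (by nlinarith)
  have hrB : rB ^ 2 = r / (1 + r) := Real.sq_sqrt (by positivity)
  have htB : tB ^ 2 = 1 / (1 + r) := Real.sq_sqrt (by positivity)
  have hB : B *ᵥ e₃ = ![0, -tB, rB] := by
    ext i; fin_cases i <;> simp [B, e₃, mulVec, dotProduct, Fin.sum_univ_three]
  have hUB : U *ᵥ ![0, -tB, rB] = ![t * tB, r * tB, rB] := by
    ext i; fin_cases i <;> simp [U, mulVec, dotProduct, Fin.sum_univ_three]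
  have hB' (x y z : ℝ) : B' *ᵥ ![x, y, z] = ![x, rB * y + tB * z, -tB * y + rB * z] := by
    ext i; fin_cases i <;> simp [B', mulVec, dotProduct, Fin.sum_univ_three]
  have hnorm : -tB * -tB + rB * rB = 1 := by
    calc -tB * -tB + rB * rB = tB ^ 2 + rB ^ 2 := by ring
      _ = 1 := by rw [htB, hrB]; field_simp
  have hcancel : rB * -tB + tB * rB = 0 := by ring
  rw [hB, hUB, hB', hB', hnorm, hcancel]
  refine ⟨rfl, ?_, ?_, ?_⟩
  · change (t * tB) ^ 2 = 1 - r
    rw [mul_pow, ht, htB]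
    field_simp
    ring
  · change (rB * (r * tB) + tB * rB) ^ 2 = r
    calc (rB * (r * tB) + tB * rB) ^ 2 = rB ^ 2 * tB ^ 2 * (1 + r) ^ 2 := by ring
      _ = r := by rw [hrB, htB]; field_simp
  · change -tB * (r * tB) + rB * rB = 0
    calc -tB * (r * tB) + rB * rB = rB ^ 2 - r * tB ^ 2 := by ring
      _ = 0 := by rw [hrB, htB]; ring
end

section
/- Let 0 ≤ r ≤ 1 and r ≤ q ≤ 1; set t_U = √(1 − r²), r_B = √((q+r)/(1+r)), t_B = √((1−q)/(1+r)), r_M = (√(1−r) − √(q(q+r)))/(1+q), t_M = (√(q(1−r)) + √(q+r))/(1+q), r_N = √(1−q), t_N = √q. Define real 3×3 matrices: B = [[r_B, −t_B],[t_B, r_B]] embedded on coordinates (2,3); U = [[−r, −t_U],[t_U, −r]] embedded on coordinates (1,2); B† = [[r_B, t_B],[−t_B, r_B]] embedded on coordinates (2,3); M = [[r_M, t_M],[−t_M, r_M]] embedded on coordinates (1,2); N = [[r_N, −t_N],[t_N, r_N]] embedded on coordinates (2,3). Let e₃ = (0,0,1). Then: (i) the vector v_U = N·M·B†·U·B·e₃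 satisfies v_U(1)² = 1 − q, v_U(2)² = q, v_U(3) = 0; (ii) the vector v_I = N·M·B†·B·e₃ satisfies v_I(1) = 0, v_I(2)² = q, v_I(3)² = 1 − q. Hence the setup unambiguously discriminates U from the identity I with a single photon: detector 1 fires only for device U (probability 1−q), detector 3 fires only for device I (probability 1−q), and detector 2 declares failure with probability q for either device. -/
open Matrix

/-- Unambiguous single-photon discrimination of a beamsplitter `U` (amplitude
reflectivity `r`) from the identity, with failure probability `q ≥ r`:
detector 1 fires only for `U` (probability `1−q`), detector 3 only for `I`
(probability `1−q`), and detector 2 declares failure (probability `q`). -/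
theorem unambiguous_quantum_reading_setup
    (r q : ℝ) (hr0 : 0 ≤ r) (hr1 : r ≤ 1) (hrq : r ≤ q) (hq1 : q ≤ 1) :
    let tU : ℝ := Real.sqrt (1 - r ^ 2)
    let rB : ℝ := Real.sqrt ((q + r) / (1 + r))
    let tB : ℝ := Real.sqrt ((1 - q) / (1 + r))
    let rM : ℝ := (Real.sqrt (1 - r) - Real.sqrt (q * (q + r))) / (1 + q)
    let tM : ℝ := (Real.sqrt (q * (1 - r)) + Real.sqrt (q + r)) / (1 + q)
    let rN : ℝ := Real.sqrt (1 - q)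
    let tN : ℝ := Real.sqrt q
    let B : Matrix (Fin 3) (Fin 3) ℝ := !![1, 0, 0; 0, rB, -tB; 0, tB, rB]
    let U : Matrix (Fin 3) (Fin 3) ℝ := !![-r, -tU, 0; tU, -r, 0; 0, 0, 1]
    let Bdag : Matrix (Fin 3) (Fin 3) ℝ := !![1, 0, 0; 0, rB, tB; 0, -tB, rB]
    let M : Matrix (Fin 3) (Fin 3) ℝ := !![rM, tM, 0; -tM, rM, 0; 0, 0, 1]
    let N : Matrix (Fin 3) (Fin 3) ℝ := !![1, 0, 0; 0, rN, -tN; 0, tN, rN]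
    let e₃ : Fin 3 → ℝ := ![0, 0, 1]
    (let vU : Fin 3 → ℝ := N *ᵥ (M *ᵥ (Bdag *ᵥ (U *ᵥ (B *ᵥ e₃))))
     vU 0 ^ 2 = 1 - q ∧ vU 1 ^ 2 = q ∧ vU 2 = 0) ∧
    (let vI : Fin 3 → ℝ := N *ᵥ (M *ᵥ (Bdag *ᵥ (B *ᵥ e₃)))
     vI 0 = 0 ∧ vI 1 ^ 2 = q ∧ vI 2 ^ 2 = 1 - q) := by
  intro tU rB tB rM tM rN tN B U Bdag M N e₃
  have hq0 : 0 ≤ q := hr0.trans hrq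
  have hc0 : 0 < 1 + r := by linarith
  have hp0 : 0 < 1 + q := by linarith
  have ha : √(1 - r) ^ 2 = 1 - r := Real.sq_sqrt (by linarith)
  have hb : √(q + r) ^ 2 = q + r := Real.sq_sqrt (by linarith)
  have hc : √(1 + r) ^ 2 = 1 + r := Real.sq_sqrt hc0.le
  have hn : rN ^ 2 = 1 - q := Real.sq_sqrt (by linarith)
  have hs : tN ^ 2 = q := Real.sq_sqrt hq0
  have hcpos : 0 < √(1 + r) := Real.sqrt_pos.2 hc0
  have htU : tU = √(1 - r) * √(1 + r) := by
    rw [← Real.sqrt_mul (by linarith)]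
    exact congrArg Real.sqrt (by ring)
  have hrB : rB = √(q + r) / √(1 + r) := Real.sqrt_div (by linarith) _
  have htB : tB = rN / √(1 + r) := Real.sqrt_div (by linarith) _
  have hrM : rM = (√(1 - r) - tN * √(q + r)) / (1 + q) := by
    simp only [rM, tN, Real.sqrt_mul hq0]
  have htM : tM = (tN * √(1 - r) + √(q + r)) / (1 + q) := by
    simp only [tM, tN, Real.sqrt_mul hq0]
  have hBB : rB ^ 2 + tB ^ 2 = 1 := by
    rw [hrB, htB, div_pow, div_pow, hb, hc, hn]
    field_simp
    ring
  have hB : rB ^ 2 - r * tB ^ 2 = q := by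
    rw [hrB, htB, div_pow, div_pow, hb, hc, hn]
    field_simp
    ring
  have hw₀ : tU * tB = rN * √(1 - r) := by
    rw [htU, htB]
    field_simp
  have hw₁ : (1 + r) * rB * tB = rN * √(q + r) := by
    rw [← hc, hrB, htB]
    field_simp
  have hM₀ : rM * √(1 - r) + tM * √(q + r) = 1 := by
    rw [hrM, htM]
    field_simp
    linear_combination ha + hb
  have hM₁ : -tM * √(1 - r) + rM * √(q + r) = -tN := by
    rw [hrM, htM]
    field_simp
    linear_combination -tN * (ha + hb)
  have hI : Bdag *ᵥ (B *ᵥ e₃) = e₃ := by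
    ext i
    fin_cases i <;> simp [Bdag, B, e₃, Matrix.mulVec, dotProduct, Fin.sum_univ_three]
    · ring
    · linear_combination hBB
  have hU : Bdag *ᵥ (U *ᵥ (B *ᵥ e₃)) = ![rN * √(1 - r), rN * √(q + r), q] := by
    ext i
    fin_cases i <;> simp [Bdag, B, U, e₃, Matrix.mulVec, dotProduct, Fin.sum_univ_three]
    · exact hw₀
    · linear_combination hw₁
    · linear_combination hB
  have hMU : M *ᵥ ![rN * √(1 - r), rN * √(q + r), q] = ![rN, -tN * rN, q] := by
    ext i
    fin_cases i <;> simp [M, Matrix.mulVec, dotProduct, Fin.sum_univ_three]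
    · linear_combination rN * hM₀
    · linear_combination rN * hM₁
  have hNU : N *ᵥ ![rN, -tN * rN, q] = ![rN, -tN, 0] := by
    ext i
    fin_cases i <;> simp [N, Matrix.mulVec, dotProduct, Fin.sum_univ_three]
    · linear_combination -tN * hn
    · linear_combination -rN * hs
  have hNI : N *ᵥ (M *ᵥ e₃) = ![0, -tN, rN] := by
    ext i
    fin_cases i <;> simp [N, M, e₃, Matrix.mulVec, dotProduct, Fin.sum_univ_three]
  rw [hI, hU, hMU, hNU, hNI]
  simp [hn, hs]
end

section
/- Let 0 ≤ r ≤ 1 and 0 ≤ q < 1/2; set K = √(4q(1−q)), t_U = √(1 − r²), r_B = √((K+r)/(1+r)), t_B = √((1−K)/(1+r)), r_M = √((1−K)(K+r))/(1−2q), t_M = √((1−K)(1−r))/(1−2q), r_N = √(1−q), t_N = √q. Define real 3×3 matrices: B = [[r_B, −t_B],[t_B, r_B]] embedded on coordinates (2,3); U = [[−r, −t_U],[t_U, −r]] embedded on coordinates (1,2); B† = [[r_B, t_B],[−t_B, r_B]] embedded on coordinates (2,3); M = [[r_M, −t_M],[t_M, r_M]] embedded on coordinates (1,2); N† = [[r_N,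 t_N],[−t_N, r_N]] embedded on coordinates (2,3). Let e₃ = (0,0,1). Then: (i) the vector v_U = N†·M·B†·U·B·e₃ satisfies v_U(1) = 0, v_U(2)² = 1 − q, v_U(3)² = q; (ii) the vector v_I = N†·M·B†·B·e₃ satisfies v_I(1) = 0, v_I(2)² = q, v_I(3)² = 1 − q. Hence the setup ambiguously discriminates U from the identity I with a single photon with error probability q: detector 2 indicates device U and detector 3 indicates device I, each guess being wrong with probability q. -/
open Matrix

/-- Ambiguous single-photon discrimination of a beamsplitter `U` (amplitude
reflectivity `r`) from the identity, with error probability `q < 1/2` and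
`K = √(4q(1−q))`: detector 2 indicates device `U` and detector 3 indicates
device `I`, each guess being wrong with probability `q`. -/
theorem ambiguous_quantum_reading_setup
    (r q : ℝ) (hr0 : 0 ≤ r) (hr1 : r ≤ 1) (hq0 : 0 ≤ q) (hq1 : q < 1 / 2) :
    let K : ℝ := Real.sqrt (4 * q * (1 - q))
    let tU : ℝ := Real.sqrt (1 - r ^ 2)
    let rB : ℝ := Real.sqrt ((K + r) / (1 + r))
    let tB : ℝ := Real.sqrt ((1 - K) / (1 + r))
    let rM : ℝ := Real.sqrt ((1 - K) * (K + r)) / (1 - 2 * q)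
    let tM : ℝ := Real.sqrt ((1 - K) * (1 - r)) / (1 - 2 * q)
    let rN : ℝ := Real.sqrt (1 - q)
    let tN : ℝ := Real.sqrt q
    let B : Matrix (Fin 3) (Fin 3) ℝ := !![1, 0, 0; 0, rB, -tB; 0, tB, rB]
    let U : Matrix (Fin 3) (Fin 3) ℝ := !![-r, -tU, 0; tU, -r, 0; 0, 0, 1]
    let Bdag : Matrix (Fin 3) (Fin 3) ℝ := !![1, 0, 0; 0, rB, tB; 0, -tB, rB]
    let M : Matrix (Fin 3) (Fin 3) ℝ := !![rM, -tM, 0; tM, rM, 0; 0, 0, 1]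
    let Ndag : Matrix (Fin 3) (Fin 3) ℝ := !![1, 0, 0; 0, rN, tN; 0, -tN, rN]
    let e₃ : Fin 3 → ℝ := ![0, 0, 1]
    (let vU : Fin 3 → ℝ := Ndag *ᵥ (M *ᵥ (Bdag *ᵥ (U *ᵥ (B *ᵥ e₃))))
     vU 0 = 0 ∧ vU 1 ^ 2 = 1 - q ∧ vU 2 ^ 2 = q) ∧
    (let vI : Fin 3 → ℝ := Ndag *ᵥ (M *ᵥ (Bdag *ᵥ (B *ᵥ e₃)))
     vI 0 = 0 ∧ vI 1 ^ 2 = q ∧ vI 2 ^ 2 = 1 - q) := by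
  intro K tU rB tB rM tM rN tN B U Bdag M Ndag e₃
  have hd : 0 < 1 - 2 * q := by linarith
  have hN : rN ^ 2 = 1 - q := Real.sq_sqrt (by linarith)
  have hT : tN ^ 2 = q := Real.sq_sqrt hq0
  have hK2 : K ^ 2 = 4 * q * (1 - q) := Real.sq_sqrt (by nlinarith)
  have hK0 : 0 ≤ K := Real.sqrt_nonneg _
  have hK1 : K ≤ 1 := by nlinarith [sq_nonneg (1 - 2 * q)]
  have hK : K = 2 * (rN * tN) := by
    have h0 : 0 ≤ 2 * (rN * tN) := by positivity
    rw [← sq_eq_sq₀ hK0 h0, hK2, mul_pow, mul_pow, hN, hT]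
    ring
  have hr : 0 < 1 + r := by linarith
  have hrB : rB ^ 2 = (K + r) / (1 + r) := Real.sq_sqrt (by positivity)
  have htB : tB ^ 2 = (1 - K) / (1 + r) :=
    Real.sq_sqrt (div_nonneg (by linarith) hr.le)
  have hsum : rB ^ 2 + tB ^ 2 = 1 := by
    rw [hrB, htB]
    field_simp
    ring
  have hdiff : rB ^ 2 - r * tB ^ 2 = K := by
    rw [hrB, htB]
    field_simp
    ring
  have htU : tU ^ 2 = 1 - r ^ 2 := Real.sq_sqrt (by nlinarith)
  have ha0 : 0 ≤ (1 - K) * (K + r) := mul_nonneg (by linarith) (by linarith)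
  have hb0 : 0 ≤ (1 - K) * (1 - r) := mul_nonneg (by linarith) (by linarith)
  have ha : (1 + r) * (rB * tB) = rM * (1 - 2 * q) := by
    have h0 : 0 ≤ (1 + r) * (rB * tB) := by positivity
    rw [div_mul_cancel₀ _ hd.ne', ← sq_eq_sq₀ h0 (Real.sqrt_nonneg _), Real.sq_sqrt ha0,
      mul_pow, mul_pow, hrB, htB]
    field_simp
  have hb : tU * tB = tM * (1 - 2 * q) := by
    have h0 : 0 ≤ tU * tB := by positivity
    rw [div_mul_cancel₀ _ hd.ne', ← sq_eq_sq₀ h0 (Real.sqrt_nonneg _), Real.sq_sqrt hb0,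
      mul_pow, htU, htB]
    field_simp
    ring
  have hM : rM ^ 2 + tM ^ 2 = 1 := by
    rw [div_pow, div_pow, Real.sq_sqrt ha0, Real.sq_sqrt hb0, ← add_div,
      div_eq_one_iff_eq (pow_pos hd 2).ne']
    linear_combination -hK2
  have hBe : B *ᵥ e₃ = ![0, -tB, rB] := by
    ext i
    fin_cases i <;> simp [B, e₃, mulVec, dotProduct, Fin.sum_univ_three]
  have hU : Bdag *ᵥ (U *ᵥ ![0, -tB, rB]) = ![tM * (1 - 2 * q), rM * (1 - 2 * q), K] := by
    rw [← ha, ← hb, ← hdiff]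
    ext i
    fin_cases i <;> simp [Bdag, U, mulVec, dotProduct, Fin.sum_univ_three] <;> ring
  have hI : Bdag *ᵥ ![0, -tB, rB] = e₃ := by
    ext i
    fin_cases i <;> simp [Bdag, e₃, mulVec, dotProduct, Fin.sum_univ_three]
    · ring
    · linear_combination hsum
  have hMU : M *ᵥ ![tM * (1 - 2 * q), rM * (1 - 2 * q), K] = ![0, 1 - 2 * q, K] := by
    ext i
    fin_cases i <;> simp [M, mulVec, dotProduct, Fin.sum_univ_three]
    · ring
    · linear_combination (1 - 2 * q) * hM
  have hMI : M *ᵥ e₃ = e₃ := by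
    ext i
    fin_cases i <;> simp [M, e₃, mulVec, dotProduct, Fin.sum_univ_three]
  have hNU : Ndag *ᵥ ![0, 1 - 2 * q, K] = ![0, rN, tN] := by
    rw [hK]
    ext i
    fin_cases i <;> simp [Ndag, mulVec, dotProduct, Fin.sum_univ_three]
    · linear_combination 2 * rN * hT
    · linear_combination 2 * tN * hN
  have hNI : Ndag *ᵥ e₃ = ![0, tN, rN] := by
    ext i
    fin_cases i <;> simp [Ndag, e₃, mulVec, dotProduct, Fin.sum_univ_three]
  rw [hBe, hU, hMU, hNU, hI, hMI, hNI]
  exact ⟨⟨rfl, hN, hT⟩, rfl, hT, hN⟩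
end
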